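/- Let f : ℍ → ℂ be defined by f(τ) = (DE₄)(τ)/(240·η(τ)¹⁰), where (DE₄)(τ) = 240∑_{n≥1} n·σ₃(n)qⁿ is the normalized derivative of E₄. Then f is holomorphic on ℍ and satisfies the second-order modular linear differential equation D²f − (1/6)·E₂·Df − (35/144)·E₄·f = 0 on ℍ (this is the MLDE of weight 0 with parameter h = 6, since (h−1)(h+1)/144 = 35/144). (In the paper, f is the normalized character of the simple affine vertex algebra V_{−2}(D₄).) -/

import Mathlib

noncomputable section

open Complex

/-- `q = exp(2πiτ)`. -/
def qc (τ : ℂ) : ℂ := Complex.exp (2 * (Real.pi : ℂ) * Complex.I * τ)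

/-- `σ_k(n) = ∑_{d ∣ n} d^k`, as a complex number. -/
def sigmaC (k n : ℕ) : ℂ := ∑ d ∈ n.divisors, (d : ℂ) ^ k

/-- Eisenstein series `E₂(τ) = 1 - 24 ∑_{n≥1} σ₁(n) qⁿ`. -/
def E2 (τ : ℂ) : ℂ := 1 - 24 * ∑' n : ℕ, sigmaC 1 (n + 1) * qc τ ^ (n + 1)

/-- Eisenstein series `E₄(τ) = 1 + 240 ∑_{n≥1} σ₃(n) qⁿ`. -/
def E4 (τ : ℂ) : ℂ := 1 + 240 * ∑' n : ℕ, sigmaC 3 (n + 1) * qc τ ^ (n + 1)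

/-- Eisenstein series `E₆(τ) = 1 - 504 ∑_{n≥1} σ₅(n) qⁿ`. -/
def E6 (τ : ℂ) : ℂ := 1 - 504 * ∑' n : ℕ, sigmaC 5 (n + 1) * qc τ ^ (n + 1)

/-- The normalized derivative of `E₄`: `(DE₄)(τ) = 240 ∑_{n≥1} n σ₃(n) qⁿ`. -/
def DE4 (τ : ℂ) : ℂ := 240 * ∑' n : ℕ, ((n : ℂ) + 1) * sigmaC 3 (n + 1) * qc τ ^ (n + 1)

/-- Dedekind eta function `η(τ) = exp(2πiτ/24) ∏_{n≥1} (1 - qⁿ)`. -/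
def dedekindEta (τ : ℂ) : ℂ :=
  Complex.exp (2 * (Real.pi : ℂ) * Complex.I * τ / 24) * ∏' n : ℕ, (1 - qc τ ^ (n + 1))

/-- Normalized derivative `D = (2πi)⁻¹ d/dτ`. -/
def Dop (f : ℂ → ℂ) : ℂ → ℂ := fun τ => (2 * (Real.pi : ℂ) * Complex.I)⁻¹ * deriv f τ

/-- The upper half-plane, as a subset of `ℂ`. -/
def UHP : Set ℂ := {τ : ℂ | 0 < τ.im}

/-- The normalized character of `V_{-2}(D₄)`: `f(τ) = (DE₄)(τ) / (240 η(τ)¹⁰)`. -/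
def charD4 (τ : ℂ) : ℂ := DE4 τ / (240 * dedekindEta τ ^ 10)


open UpperHalfPlane hiding I
open scoped Manifold MatrixGroups ModularForm Topology
open Filter

/-! ### q-series -/

/-- The sum of the `q`-series with coefficients `σ_k(n)`. -/
def qS (k : ℕ) (q : ℂ) : ℂ := ∑' n : ℕ, sigmaC k (n + 1) * q ^ (n + 1)

lemma sigmaC_eq (k n : ℕ) : sigmaC k n = (ArithmeticFunction.sigma k n : ℂ) := by
  simp [sigmaC, ArithmeticFunction.sigma_apply]

lemma norm_sigmaC_le (k n : ℕ) : ‖sigmaC k n‖ ≤ (n : ℝ) ^ (k + 1) := by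
  rw [sigmaC_eq, Complex.norm_natCast]
  exact_mod_cast ArithmeticFunction.sigma_le_pow_succ k n

lemma summable_bound (k : ℕ) {r : ℝ} (h0 : 0 ≤ r) (hr : r < 1) :
    Summable fun n : ℕ => ((n + 1 : ℕ) : ℝ) ^ (k + 1) * r ^ (n + 1) := by
  have := summable_pow_mul_geometric_of_norm_lt_one (R := ℝ) (k + 1) (r := r)
    (by rwa [Real.norm_of_nonneg h0])
  exact (summable_nat_add_iff (f := fun n : ℕ => (n : ℝ) ^ (k + 1) * r ^ n) 1).mpr this

lemma term_bound (k : ℕ) {r : ℝ} (n : ℕ) (w : ℂ) (hw : w ∈ Metric.ball (0 : ℂ) r) :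
    ‖sigmaC k (n + 1) * w ^ (n + 1)‖ ≤ ((n + 1 : ℕ) : ℝ) ^ (k + 1) * r ^ (n + 1) := by
  rw [norm_mul, norm_pow]
  have : ‖w‖ ≤ r := by simpa using (mem_ball_zero_iff.mp hw).le
  gcongr
  exact norm_sigmaC_le k (n + 1)

lemma qS_differentiableOn (k : ℕ) : DifferentiableOn ℂ (qS k) (Metric.ball 0 1) := by
  intro z hz
  obtain ⟨r, hr1, hr2⟩ := exists_between (mem_ball_zero_iff.mp hz)
  have hzr : z ∈ Metric.ball (0 : ℂ) r := by simpa using hr1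
  have := differentiableOn_tsum_of_summable_norm (U := Metric.ball (0 : ℂ) r)
    (F := fun (n : ℕ) (w : ℂ) => sigmaC k (n + 1) * w ^ (n + 1))
    (summable_bound k ((norm_nonneg _).trans hr1.le) hr2)
    (fun n => by fun_prop) Metric.isOpen_ball (fun n w hw => term_bound k n w hw)
  exact (this.differentiableAt (Metric.isOpen_ball.mem_nhds hzr)).differentiableWithinAt

lemma qS_deriv (k : ℕ) {z : ℂ} (hz : z ∈ Metric.ball (0 : ℂ) 1) :
    z * deriv (qS k) z = ∑' n : ℕ, ((n : ℂ) + 1) * sigmaC k (n + 1) * z ^ (n + 1) := by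
  obtain ⟨r, hr1, hr2⟩ := exists_between (mem_ball_zero_iff.mp hz)
  have hzr : z ∈ Metric.ball (0 : ℂ) r := by simpa using hr1
  have := hasSum_deriv_of_summable_norm (U := Metric.ball (0 : ℂ) r)
    (F := fun (n : ℕ) (w : ℂ) => sigmaC k (n + 1) * w ^ (n + 1))
    (summable_bound k ((norm_nonneg _).trans hr1.le) hr2)
    (fun n => by fun_prop) Metric.isOpen_ball (fun n w hw => term_bound k n w hw) hzr
  have h2 := this.mul_left z
  change HasSum _ (z * deriv (qS k) z) at h2
  rw [← h2.tsum_eq]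
  refine tsum_congr fun n => ?_
  simp
  ring

lemma qc_mem {τ : ℂ} (h : 0 < τ.im) : qc τ ∈ Metric.ball (0 : ℂ) 1 := by
  rw [mem_ball_zero_iff]
  exact UpperHalfPlane.norm_exp_two_pi_I_lt_one ⟨τ, h⟩

lemma qc_hasDerivAt (τ : ℂ) : HasDerivAt qc (2 * (Real.pi : ℂ) * I * qc τ) τ := by
  have h1 : HasDerivAt (fun t : ℂ => 2 * (Real.pi : ℂ) * I * t) (2 * (Real.pi : ℂ) * I) τ := by
    simpa using (hasDerivAt_id τ).const_mul (2 * (Real.pi : ℂ) * I)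
  have := h1.cexp
  exact this.congr_deriv (mul_comm _ _)

lemma tsum_pnat_sigma (k : ℕ) (q : ℂ) :
    ∑' n : ℕ+, (ArithmeticFunction.sigma k n : ℂ) * q ^ (n : ℕ) = qS k q := by
  rw [tsum_pnat_eq_tsum_succ (f := fun n => (ArithmeticFunction.sigma k n : ℂ) * q ^ n)]
  simp [qS, sigmaC_eq]

lemma E2_bridge (z : ℍ) : EisensteinSeries.E2 z = E2 z := by
  rw [EisensteinSeries.E2_eq_tsum_cexp, E2]
  congr 2
  exact tsum_pnat_sigma 1 (qc z)

lemma E4_bridge (z : ℍ) : ModularForm.E (k := 4) (by norm_num) z = E4 z := by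
  rw [EisensteinSeries.q_expansion_bernoulli _ ⟨2, rfl⟩, E4]
  have := tsum_pnat_sigma 3 (qc z)
  simp only [qS, qc] at this
  simp only [zpow_natCast, Nat.add_one_sub_one, qc]
  rw [this]
  norm_num [show bernoulli 4 = -1 / 30 by decide +kernel]

lemma E6_bridge (z : ℍ) : ModularForm.E (k := 6) (by norm_num) z = E6 z := by
  rw [EisensteinSeries.q_expansion_bernoulli _ ⟨3, rfl⟩, E6]
  have := tsum_pnat_sigma 5 (qc z)
  simp only [qS, qc] at this
  simp only [zpow_natCast, Nat.add_one_sub_one, qc]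
  rw [this]
  norm_num [show bernoulli 6 = 1 / 42 by decide +kernel]

lemma eta_bridge : dedekindEta = ModularForm.eta := by
  ext τ
  simp [dedekindEta, ModularForm.eta, ModularForm.eta_q, Function.Periodic.qParam, qc]

lemma qS_qc_hasDerivAt (k : ℕ) {τ : ℂ} (h : 0 < τ.im) :
    HasDerivAt (fun t => qS k (qc t))
      (2 * (Real.pi : ℂ) * I * (qc τ * deriv (qS k) (qc τ))) τ := by
  have h1 := ((qS_differentiableOn k).differentiableAt
    (Metric.isOpen_ball.mem_nhds (qc_mem h))).hasDerivAt
  have := h1.comp τ (qc_hasDerivAt τ)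
  refine HasDerivAt.congr_deriv this ?_
  ring

lemma qS_zero (k : ℕ) : qS k 0 = 0 := by simp [qS]

lemma tendsto_qc : Tendsto (fun z : ℍ => qc z) atImInfty (𝓝 0) := by
  simpa [Function.Periodic.qParam, qc] using
    UpperHalfPlane.qParam_tendsto_atImInfty (h := 1) zero_lt_one

lemma tendsto_qS (k : ℕ) : Tendsto (fun z : ℍ => qS k (qc z)) atImInfty (𝓝 0) := by
  have h : ContinuousAt (qS k) 0 := ((qS_differentiableOn k).differentiableAt
    (Metric.isOpen_ball.mem_nhds (by simp))).continuousAt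
  have := h.tendsto.comp tendsto_qc
  rwa [qS_zero] at this

lemma tendsto_qdS (k : ℕ) :
    Tendsto (fun z : ℍ => qc z * deriv (qS k) (qc z)) atImInfty (𝓝 0) := by
  have h : ContinuousAt (deriv (qS k)) 0 := (((qS_differentiableOn k).deriv
    Metric.isOpen_ball).differentiableAt (Metric.isOpen_ball.mem_nhds (by simp))).continuousAt
  simpa using tendsto_qc.mul (h.tendsto.comp tendsto_qc)

/-! ### bridging derivatives -/

lemma Dnorm_eq {F : ℍ → ℂ} {f : ℂ → ℂ} (h : ∀ z : ℍ, F z = f z) {f' : ℂ} (z : ℍ)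
    (hf : HasDerivAt f (2 * (Real.pi : ℂ) * I * f') z) :
    Derivative.normalizedDerivOfComplex F z = f' := by
  have hev : F ∘ ofComplex =ᶠ[𝓝 (z : ℂ)] f := by
    filter_upwards [isOpen_upperHalfPlaneSet.mem_nhds z.im_pos] with w hw
    simp [h, ofComplex_apply_of_im_pos hw]
  rw [Derivative.normalizedDerivOfComplex, (hf.congr_of_eventuallyEq hev).deriv]
  have : (2 * (Real.pi : ℂ) * I) ≠ 0 := by simp [Real.pi_ne_zero]
  field_simp

lemma E2_hasDerivAt {τ : ℂ} (h : 0 < τ.im) :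
    HasDerivAt E2 (2 * (Real.pi : ℂ) * I * (-24 * (qc τ * deriv (qS 1) (qc τ)))) τ := by
  have := ((qS_qc_hasDerivAt 1 h).const_mul 24).const_sub 1
  refine HasDerivAt.congr_deriv this ?_
  ring

lemma E4_hasDerivAt {τ : ℂ} (h : 0 < τ.im) :
    HasDerivAt E4 (2 * (Real.pi : ℂ) * I * (240 * (qc τ * deriv (qS 3) (qc τ)))) τ := by
  have := ((qS_qc_hasDerivAt 3 h).const_mul 240).const_add 1
  refine HasDerivAt.congr_deriv this ?_
  ring

lemma E6_hasDerivAt {τ : ℂ} (h : 0 < τ.im) :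
    HasDerivAt E6 (2 * (Real.pi : ℂ) * I * (-504 * (qc τ * deriv (qS 5) (qc τ)))) τ := by
  have := ((qS_qc_hasDerivAt 5 h).const_mul 504).const_sub 1
  refine HasDerivAt.congr_deriv this ?_
  ring

lemma tendsto_E2 : Tendsto (fun z : ℍ => E2 z) atImInfty (𝓝 1) := by
  simpa [E2, qS] using ((tendsto_qS 1).const_mul 24).const_sub 1

lemma tendsto_E4 : Tendsto (fun z : ℍ => E4 z) atImInfty (𝓝 1) := by
  simpa [E4, qS] using ((tendsto_qS 3).const_mul 240).const_add 1

lemma tendsto_E6 : Tendsto (fun z : ℍ => E6 z) atImInfty (𝓝 1) := by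
  simpa [E6, qS] using ((tendsto_qS 5).const_mul 504).const_sub 1

/-! ### vanishing of low weight cusp forms -/

lemma eq_zero_of_low_weight {k : ℤ} (hk : k < 12) {F : ℍ → ℂ} (hF : MDiff F)
    (hs : ∀ γ : SL(2, ℤ), F ∣[k] γ = F) (h0 : Tendsto F atImInfty (𝓝 0)) (z : ℍ) : F z = 0 := by
  let f : CuspForm 𝒮ℒ k :=
    { toFun := F
      slash_action_eq' := by
        rintro A ⟨A, rfl⟩
        exact hs A
      holo' := hF
      zero_at_cusps' := by
        intro c hc
        rw [Subgroup.IsArithmetic.isCusp_iff_isCusp_SL2Z] at hc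
        rw [OnePoint.isZeroAt_iff_forall_SL2Z hc]
        intro γ _
        rw [hs]
        exact h0 }
  have : f = 0 := rank_zero_iff_forall_zero.mp (CuspForm.rank_eq_zero_of_weight_lt_twelve hk) f
  exact congrArg (fun g : CuspForm 𝒮ℒ k => g z) this

/-! ### Ramanujan's identities -/

local notation "cE2" => EisensteinSeries.E2

/-- The Eisenstein series of weight 4 as a function on the upper half plane. -/
def mE4 : ModularForm 𝒮ℒ 4 := ModularForm.E (k := 4) (by norm_num)

/-- The Eisenstein series of weight 6 as a function on the upper half plane. -/
def mE6 : ModularForm 𝒮ℒ 6 := ModularForm.E (k := 6) (by norm_num)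

lemma mE4_apply (z : ℍ) : mE4 z = E4 z := E4_bridge z

lemma mE6_apply (z : ℍ) : mE6 z = E6 z := E6_bridge z

lemma mE4_slash (γ : SL(2, ℤ)) : (⇑mE4) ∣[(4 : ℤ)] γ = ⇑mE4 :=
  SlashInvariantForm.slash_action_eqn mE4.toSlashInvariantForm _ ⟨γ, rfl⟩

lemma mE6_slash (γ : SL(2, ℤ)) : (⇑mE6) ∣[(6 : ℤ)] γ = ⇑mE6 :=
  SlashInvariantForm.slash_action_eqn mE6.toSlashInvariantForm _ ⟨γ, rfl⟩

lemma E4_MDiff : MDiff (⇑mE4) := mE4.holo'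

lemma E6_MDiff : MDiff (⇑mE6) := mE6.holo'

lemma D_E2_eq (z : ℍ) : Derivative.normalizedDerivOfComplex cE2 z =
    -24 * (qc z * deriv (qS 1) (qc z)) :=
  Dnorm_eq E2_bridge z (E2_hasDerivAt z.2)

lemma D_E4_eq (z : ℍ) : Derivative.normalizedDerivOfComplex mE4 z =
    240 * (qc z * deriv (qS 3) (qc z)) :=
  Dnorm_eq mE4_apply z (E4_hasDerivAt z.2)

lemma D_E6_eq (z : ℍ) : Derivative.normalizedDerivOfComplex mE6 z =
    -504 * (qc z * deriv (qS 5) (qc z)) :=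
  Dnorm_eq mE6_apply z (E6_hasDerivAt z.2)

lemma ram4 (z : ℍ) : 240 * (qc z * deriv (qS 3) (qc z)) = (E2 z * E4 z - E6 z) / 3 := by
  have key := eq_zero_of_low_weight (k := 6) (by norm_num)
    (F := Derivative.serreDerivative (4 : ℤ) mE4 + (1 / 3 : ℂ) • ⇑mE6)
    ((Derivative.serreDerivative_mdifferentiable _ E4_MDiff).add (E6_MDiff.const_smul _))
    (fun γ => by
      have h1 := Derivative.serreDerivative_slash_invariant E4_MDiff (mE4_slash γ)
      norm_num only at h1
      rw [SlashAction.add_slash, ModularForm.SL_smul_slash, mE6_slash]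
      congr 1)
    (by
      have h := ((((tendsto_qdS 3).const_mul 240).sub
        ((tendsto_E2.mul tendsto_E4).const_mul (1 / 3))).add (tendsto_E6.const_mul (1 / 3)))
      convert h using 2 with z
      · simp only [Pi.add_apply, Derivative.serreDerivative_apply, D_E4_eq, Pi.smul_apply,
          mE4_apply, mE6_apply, E2_bridge, smul_eq_mul]
        push_cast
        ring
      · norm_num) z
  simp only [Pi.add_apply, Derivative.serreDerivative_apply, D_E4_eq, Pi.smul_apply,
    mE4_apply, mE6_apply, E2_bridge, smul_eq_mul] at key
  push_cast at key
  linear_combination key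

lemma ram6 (z : ℍ) : -504 * (qc z * deriv (qS 5) (qc z)) = (E2 z * E6 z - E4 z ^ 2) / 2 := by
  have key := eq_zero_of_low_weight (k := 8) (by norm_num)
    (F := Derivative.serreDerivative (6 : ℤ) mE6 + (1 / 2 : ℂ) • (⇑mE4 * ⇑mE4))
    ((Derivative.serreDerivative_mdifferentiable _ E6_MDiff).add
      ((E4_MDiff.mul E4_MDiff).const_smul _))
    (fun γ => by
      have h1 := Derivative.serreDerivative_slash_invariant E6_MDiff (mE6_slash γ)
      have h2 := ModularForm.mul_slash_SL2 4 4 γ mE4 mE4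
      rw [mE4_slash] at h2
      norm_num only at h1 h2
      rw [SlashAction.add_slash, ModularForm.SL_smul_slash, h2]
      congr 1)
    (by
      have h := ((((tendsto_qdS 5).const_mul (-504)).sub
        ((tendsto_E2.mul tendsto_E6).const_mul (1 / 2))).add
          ((tendsto_E4.mul tendsto_E4).const_mul (1 / 2)))
      convert h using 2 with z
      · simp only [Pi.add_apply, Derivative.serreDerivative_apply, D_E6_eq, Pi.smul_apply,
          Pi.mul_apply, mE4_apply, mE6_apply, E2_bridge, smul_eq_mul]
        push_cast
        ring
      · norm_num) z
  simp only [Pi.add_apply, Derivative.serreDerivative_apply, D_E6_eq, Pi.smul_apply,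
    Pi.mul_apply, mE4_apply, mE6_apply, E2_bridge, smul_eq_mul] at key
  push_cast at key
  linear_combination key

/-- The cocycle `c / (2πi(cz+d))`. -/
def wcoc (γ : SL(2, ℤ)) (z : ℍ) : ℂ := (2 * (Real.pi : ℂ) * I)⁻¹ * ((γ 1 0 : ℂ) / denom γ z)

lemma E2_slash' (γ : SL(2, ℤ)) : cE2 ∣[(2 : ℤ)] γ = cE2 + (12 : ℂ) • wcoc γ := by
  ext z
  rw [EisensteinSeries.E2_slash_action]
  have hpi : (Real.pi : ℂ) ≠ 0 := by simp [Real.pi_ne_zero]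
  have hd : denom γ z ≠ 0 := denom_ne_zero _ z
  simp only [Pi.sub_apply, Pi.smul_apply, Pi.add_apply, smul_eq_mul, EisensteinSeries.D2, wcoc,
    riemannZeta_two]
  field_simp
  linear_combination (-12 * (γ 1 0 : ℂ)) * I_sq

lemma wcoc_hasDerivAt (γ : SL(2, ℤ)) (z : ℍ) :
    HasDerivAt (fun t : ℂ => (2 * (Real.pi : ℂ) * I)⁻¹ * ((γ 1 0 : ℂ) / denom γ t))
      (2 * (Real.pi : ℂ) * I * (-(wcoc γ z) ^ 2)) z := by
  have hd : denom γ z ≠ 0 := denom_ne_zero _ z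
  have h := (hasDerivAt_denom_zpow γ (-1) z).const_mul
    ((2 * (Real.pi : ℂ) * I)⁻¹ * (γ 1 0 : ℂ))
  have hpi : (Real.pi : ℂ) ≠ 0 := by simp [Real.pi_ne_zero]
  refine (h.congr_deriv ?_).congr_of_eventuallyEq (.of_forall fun t => ?_)
  · rw [wcoc, show (-1 - 1 : ℤ) = -(2 : ℕ) by norm_num, zpow_neg, zpow_natCast]
    simp
    field_simp
    rw [I_sq]
    ring
  · simp [div_eq_mul_inv, mul_assoc]

lemma ram2 (z : ℍ) : -24 * (qc z * deriv (qS 1) (qc z)) = (E2 z ^ 2 - E4 z) / 12 := by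
  have key := eq_zero_of_low_weight (k := 4) (by norm_num)
    (F := Derivative.normalizedDerivOfComplex cE2 - (1 / 12 : ℂ) • (cE2 * cE2) +
      (1 / 12 : ℂ) • ⇑mE4)
    (((Derivative.normalizedDerivOfComplex_mdifferentiable E2_mdifferentiable).sub
      ((E2_mdifferentiable.mul E2_mdifferentiable).const_smul _)).add (E4_MDiff.const_smul _))
    (fun γ => by
      have h1 := Derivative.normalizedDerivOfComplex_SL_slash (k := 2) E2_mdifferentiable (γ := γ)
      have h2 := ModularForm.mul_slash_SL2 2 2 γ cE2 cE2
      have hw : MDiff (wcoc γ) := by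
        rw [UpperHalfPlane.mdifferentiable_iff]
        intro t ht
        refine ((wcoc_hasDerivAt γ ⟨t, ht⟩).differentiableAt.congr_of_eventuallyEq
          ?_).differentiableWithinAt
        filter_upwards [isOpen_upperHalfPlaneSet.mem_nhds ht] with w hw
        simp [wcoc, ofComplex_apply_of_im_pos hw]
      rw [E2_slash'] at h1 h2
      rw [Derivative.normalizedDerivOfComplex_add _ _ E2_mdifferentiable (hw.const_smul _),
        Derivative.normalizedDerivOfComplex_smul _ _ hw] at h1
      norm_num only at h1 h2
      rw [SlashAction.add_slash, sub_eq_add_neg, SlashAction.add_slash, SlashAction.neg_slash,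
        ModularForm.SL_smul_slash, ModularForm.SL_smul_slash, mE4_slash, h2]
      ext z
      have h3 := congrFun h1 z
      have h4 : Derivative.normalizedDerivOfComplex (wcoc γ) z = -(wcoc γ z) ^ 2 :=
        Dnorm_eq (fun _ => rfl) z (wcoc_hasDerivAt γ z)
      simp only [Pi.add_apply, Pi.sub_apply, Pi.smul_apply, smul_eq_mul, h4, Pi.neg_apply,
        Pi.mul_apply] at h3 ⊢
      have h5 : (2 * (Real.pi : ℂ) * I)⁻¹ * ((γ 1 0 : ℂ) / denom γ z) = wcoc γ z := rfl
      rw [mul_assoc _ _ ((γ 1 0 : ℂ) / denom γ z), h5] at h3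
      linear_combination -h3)
    (by
      have h := ((((tendsto_qdS 1).const_mul (-24)).sub
        ((tendsto_E2.mul tendsto_E2).const_mul (1 / 12))).add
          (tendsto_E4.const_mul (1 / 12)))
      convert h using 2 with z
      · simp only [Pi.add_apply, Pi.sub_apply, D_E2_eq, Pi.smul_apply,
          Pi.mul_apply, mE4_apply, E2_bridge, smul_eq_mul]
      · norm_num) z
  simp only [Pi.add_apply, Pi.sub_apply, D_E2_eq, Pi.smul_apply,
    Pi.mul_apply, mE4_apply, E2_bridge, smul_eq_mul] at key
  linear_combination key

/-! ### the differential equation -/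

local notation "cc" => (2 * (Real.pi : ℂ) * I)

lemma dE2 {τ : ℂ} (h : τ ∈ UHP) : HasDerivAt E2 (cc * ((E2 τ ^ 2 - E4 τ) / 12)) τ :=
  (ram2 ⟨τ, h⟩) ▸ E2_hasDerivAt h

lemma dE4 {τ : ℂ} (h : τ ∈ UHP) : HasDerivAt E4 (cc * ((E2 τ * E4 τ - E6 τ) / 3)) τ :=
  (ram4 ⟨τ, h⟩) ▸ E4_hasDerivAt h

lemma dE6 {τ : ℂ} (h : τ ∈ UHP) : HasDerivAt E6 (cc * ((E2 τ * E6 τ - E4 τ ^ 2) / 2)) τ :=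
  (ram6 ⟨τ, h⟩) ▸ E6_hasDerivAt h

lemma DE4_eq {τ : ℂ} (h : τ ∈ UHP) : DE4 τ = (E2 τ * E4 τ - E6 τ) / 3 := by
  rw [← ram4 ⟨τ, h⟩, DE4, qS_deriv 3 (qc_mem h)]

lemma eta_ne {τ : ℂ} (h : τ ∈ UHP) : dedekindEta τ ≠ 0 := by
  rw [eta_bridge]; exact ModularForm.eta_ne_zero h

lemma dEta {τ : ℂ} (h : τ ∈ UHP) :
    HasDerivAt dedekindEta (cc * (E2 τ / 24 * dedekindEta τ)) τ := by
  have h1 := ModularForm.logDeriv_eta_eq_E2 ⟨τ, h⟩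
  have h2 := (ModularForm.differentiableAt_eta_of_mem_upperHalfPlaneSet h).hasDerivAt
  have h3 := eta_ne h
  rw [E2_bridge] at h1
  rw [eta_bridge] at h3 ⊢
  refine h2.congr_deriv ?_
  rw [logDeriv_apply, div_eq_iff h3] at h1
  refine h1.trans ?_
  change _ * E2 τ * _ = _
  ring

lemma isOpen_UHP : IsOpen UHP := isOpen_upperHalfPlaneSet

/-- Quotient rule by `720 η^10`. -/
lemma d_quot {N : ℂ → ℂ} {N' τ : ℂ} (h : τ ∈ UHP) (hN : HasDerivAt N (cc * N') τ) :
    HasDerivAt (fun t => N t / (720 * dedekindEta t ^ 10))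
      (cc * ((N' - 5 / 12 * E2 τ * N τ) / (720 * dedekindEta τ ^ 10))) τ := by
  have hne := eta_ne h
  have h2 := ((dEta h).pow 10).const_mul 720
  have h3 := hN.div h2 (mul_ne_zero (by norm_num) (pow_ne_zero 10 hne))
  refine HasDerivAt.congr_deriv h3 ?_
  simp only [Pi.pow_apply]
  field_simp
  push_cast
  ring

lemma Dop_of {f g : ℂ → ℂ} {f' τ : ℂ} (h : τ ∈ UHP) (he : Set.EqOn f g UHP)
    (hg : HasDerivAt g (cc * f') τ) : HasDerivAt f (cc * f') τ ∧ Dop f τ = f' := by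
  have hev : f =ᶠ[𝓝 τ] g := he.eventuallyEq_of_mem (isOpen_UHP.mem_nhds h)
  have h1 := hg.congr_of_eventuallyEq hev
  refine ⟨h1, ?_⟩
  rw [Dop, h1.deriv]
  have : cc ≠ 0 := by simp [Real.pi_ne_zero]
  field_simp

lemma charD4_eq : Set.EqOn charD4
    (fun t => (E2 t * E4 t - E6 t) / (720 * dedekindEta t ^ 10)) UHP := by
  intro t ht
  have := eta_ne ht
  simp only [charD4, DE4_eq ht]
  field_simp
  ring

lemma charD4_D {τ : ℂ} (h : τ ∈ UHP) :
    HasDerivAt charD4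
      (cc * (5 / 12 * (E4 τ ^ 2 - E2 τ * E6 τ) / (720 * dedekindEta τ ^ 10))) τ ∧
    Dop charD4 τ = 5 / 12 * (E4 τ ^ 2 - E2 τ * E6 τ) / (720 * dedekindEta τ ^ 10) := by
  refine Dop_of h charD4_eq ?_
  have hN : HasDerivAt (fun t => E2 t * E4 t - E6 t)
      (cc * ((E2 τ ^ 2 - E4 τ) / 12 * E4 τ + E2 τ * ((E2 τ * E4 τ - E6 τ) / 3)
        - (E2 τ * E6 τ - E4 τ ^ 2) / 2)) τ :=
    HasDerivAt.congr_deriv (((dE2 h).mul (dE4 h)).sub (dE6 h)) (by ring)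
  exact HasDerivAt.congr_deriv (d_quot h hN) (by ring)

lemma charD4_DD {τ : ℂ} (h : τ ∈ UHP) :
    Dop (Dop charD4) τ = 5 / 12 * (3 / 4 * E2 τ * E4 τ ^ 2 - 7 / 12 * E4 τ * E6 τ
      - 1 / 6 * E2 τ ^ 2 * E6 τ) / (720 * dedekindEta τ ^ 10) := by
  refine (Dop_of h (fun t ht => (charD4_D ht).2) ?_).2
  have hN : HasDerivAt (fun t => 5 / 12 * (E4 t ^ 2 - E2 t * E6 t))
      (cc * (5 / 12 * (2 * E4 τ * ((E2 τ * E4 τ - E6 τ) / 3) - ((E2 τ ^ 2 - E4 τ) / 12 * E6 τ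
        + E2 τ * ((E2 τ * E6 τ - E4 τ ^ 2) / 2))))) τ :=
    HasDerivAt.congr_deriv ((((dE4 h).pow 2).sub ((dE2 h).mul (dE6 h))).const_mul (5 / 12))
      (by push_cast; ring)
  exact HasDerivAt.congr_deriv (d_quot h hN) (by ring)

theorem charD4_holo_and_MLDE :
    DifferentiableOn ℂ charD4 UHP ∧
      ∀ τ ∈ UHP,
        Dop (Dop charD4) τ - (1 / 6 : ℂ) * E2 τ * Dop charD4 τ
          - (35 / 144 : ℂ) * E4 τ * charD4 τ = 0 := by
  refine ⟨fun τ h => (charD4_D h).1.differentiableAt.differentiableWithinAt, fun τ h => ?_⟩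
  rw [charD4_DD h, (charD4_D h).2, charD4_eq h]
  ring
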